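/- Assume the standing assumptions and λ > 0. Then for every Y ∈ 𝒴 and all X, X̄ ∈ 𝒳: −((L_ρ + λ⁻¹)/2)·‖X − X̄‖_F² ≤ ℒ_ρ(X,Y) − ℒ_{X̄,λ}(X,Y) ≤ ((L_ρ − λ⁻¹)/2)·‖X − X̄‖_F². -/

import Mathlib

open Matrix

noncomputable section

/-- Frobenius inner product `⟨A,B⟩ = tr(AᵀB)`. -/
def frobInner {m n : ℕ} (A B : Matrix (Fin m) (Fin n) ℝ) : ℝ := (Aᵀ * B).trace

/-- Frobenius norm. -/
def frobNorm {m n : ℕ} (A : Matrix (Fin m) (Fin n) ℝ) : ℝ := Real.sqrt (frobInner A A)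

/-- Spectral (operator) norm of a matrix. -/
def specNorm {m n : ℕ} (A : Matrix (Fin m) (Fin n) ℝ) : ℝ :=
  ‖LinearMap.toContinuousLinearMap (Matrix.toEuclideanLin A)‖

/-- `G(X) := XᵀX − Iₙ`. -/
def Gm {m n : ℕ} (X : Matrix (Fin m) (Fin n) ℝ) : Matrix (Fin n) (Fin n) ℝ := Xᵀ * X - 1

/-- `gradl` is the (Fréchet) gradient of `ℓ` w.r.t. the Frobenius inner product. -/
def IsGradientOf {m n : ℕ} (gradl : Matrix (Fin m) (Fin n) ℝ → Matrix (Fin m) (Fin n) ℝ)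
    (ℓ : Matrix (Fin m) (Fin n) ℝ → ℝ) : Prop :=
  ∀ X : Matrix (Fin m) (Fin n) ℝ, ∀ c : ℝ, 0 < c → ∃ δ : ℝ, 0 < δ ∧
    ∀ H : Matrix (Fin m) (Fin n) ℝ, frobNorm H ≤ δ →
      |ℓ (X + H) - ℓ X - frobInner (gradl X) H| ≤ c * frobNorm H

/-- Augmented Lagrangian `ℒ_ρ(X,Y) = f(X) + ⟨Y, G(X)⟩ + (ρ/2)‖G(X)‖_F²` with `f = ℓ + g`. -/
def Lag {m n : ℕ} (ℓ g : Matrix (Fin m) (Fin n) ℝ → ℝ) (ρ : ℝ)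
    (X : Matrix (Fin m) (Fin n) ℝ) (Y : Matrix (Fin n) (Fin n) ℝ) : ℝ :=
  ℓ X + g X + frobInner Y (Gm X) + ρ / 2 * frobNorm (Gm X) ^ 2

/-- `F(X,Y,Z) = ℒ_ρ(X,Y) − (ε/2)‖Y‖_F² + (r/2)‖X−Z‖_F²`. -/
def Ffun {m n : ℕ} (ℓ g : Matrix (Fin m) (Fin n) ℝ → ℝ) (ρ r ε : ℝ)
    (X : Matrix (Fin m) (Fin n) ℝ) (Y : Matrix (Fin n) (Fin n) ℝ)
    (Z : Matrix (Fin m) (Fin n) ℝ) : ℝ :=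
  Lag ℓ g ρ X Y - ε / 2 * frobNorm Y ^ 2 + r / 2 * frobNorm (X - Z) ^ 2

/-- Dual function `d(Y,Z) = min_{X ∈ 𝒳} F(X,Y,Z)`. -/
def dfun {m n : ℕ} (𝒳 : Set (Matrix (Fin m) (Fin n) ℝ))
    (ℓ g : Matrix (Fin m) (Fin n) ℝ → ℝ) (ρ r ε : ℝ)
    (Y : Matrix (Fin n) (Fin n) ℝ) (Z : Matrix (Fin m) (Fin n) ℝ) : ℝ :=
  sInf ((fun X => Ffun ℓ g ρ r ε X Y Z) '' 𝒳)

/-- Proximal function `p(Z) = max_{Y ∈ 𝒴} d(Y,Z)`. -/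
def pfun {m n : ℕ} (𝒳 : Set (Matrix (Fin m) (Fin n) ℝ))
    (𝒴 : Set (Matrix (Fin n) (Fin n) ℝ))
    (ℓ g : Matrix (Fin m) (Fin n) ℝ → ℝ) (ρ r ε : ℝ)
    (Z : Matrix (Fin m) (Fin n) ℝ) : ℝ :=
  sSup ((fun Y => dfun 𝒳 ℓ g ρ r ε Y Z) '' 𝒴)

/-- Potential function `Φ(X,Y,Z) = F(X,Y,Z) − 2d(Y,Z) + 2p(Z)`. -/
def Phi {m n : ℕ} (𝒳 : Set (Matrix (Fin m) (Fin n) ℝ))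
    (𝒴 : Set (Matrix (Fin n) (Fin n) ℝ))
    (ℓ g : Matrix (Fin m) (Fin n) ℝ → ℝ) (ρ r ε : ℝ)
    (X : Matrix (Fin m) (Fin n) ℝ) (Y : Matrix (Fin n) (Fin n) ℝ)
    (Z : Matrix (Fin m) (Fin n) ℝ) : ℝ :=
  Ffun ℓ g ρ r ε X Y Z - 2 * dfun 𝒳 ℓ g ρ r ε Y Z + 2 * pfun 𝒳 𝒴 ℓ g ρ r ε Z

/-- Linearized augmented Lagrangian `ℒ_{X̄,λ}(X,Y)`. -/
def LinLag {m n : ℕ} (ℓ g : Matrix (Fin m) (Fin n) ℝ → ℝ)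
    (gradl : Matrix (Fin m) (Fin n) ℝ → Matrix (Fin m) (Fin n) ℝ) (ρ lam : ℝ)
    (Xb X : Matrix (Fin m) (Fin n) ℝ) (Y : Matrix (Fin n) (Fin n) ℝ) : ℝ :=
  ℓ Xb + frobInner Y (Gm Xb) + ρ / 2 * frobNorm (Gm Xb) ^ 2 + g X
    + frobInner (gradl Xb) (X - Xb)
    + frobInner ((2 : ℝ) • (Xb * (Y + ρ • Gm Xb))) (X - Xb)
    + 1 / (2 * lam) * frobNorm (X - Xb) ^ 2

section FrobeniusGeometry

variable {m n p : ℕ}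

theorem frobInner_eq_sum (A B : Matrix (Fin m) (Fin n) ℝ) :
    frobInner A B = ∑ j, ∑ i, A i j * B i j := by
  simp [frobInner, Matrix.trace, Matrix.mul_apply]

theorem frobInner_comm (A B : Matrix (Fin m) (Fin n) ℝ) : frobInner A B = frobInner B A := by
  simp only [frobInner_eq_sum, mul_comm]

theorem frobInner_add_left (A B C : Matrix (Fin m) (Fin n) ℝ) :
    frobInner (A + B) C = frobInner A C + frobInner B C := by
  simp [frobInner, Matrix.add_mul]

theorem frobInner_add_right (A B C : Matrix (Fin m) (Fin n) ℝ) :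
    frobInner A (B + C) = frobInner A B + frobInner A C := by
  simp [frobInner, Matrix.mul_add]

theorem frobInner_sub_left (A B C : Matrix (Fin m) (Fin n) ℝ) :
    frobInner (A - B) C = frobInner A C - frobInner B C := by
  simp [frobInner, Matrix.sub_mul]

theorem frobInner_smul_left (c : ℝ) (A B : Matrix (Fin m) (Fin n) ℝ) :
    frobInner (c • A) B = c * frobInner A B := by
  simp [frobInner]

theorem frobInner_smul_right (c : ℝ) (A B : Matrix (Fin m) (Fin n) ℝ) :
    frobInner A (c • B) = c * frobInner A B := by
  simp [frobInner]

theorem frobInner_self_nonneg (A : Matrix (Fin m) (Fin n) ℝ) : 0 ≤ frobInner A A := by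
  rw [frobInner_eq_sum]
  exact Finset.sum_nonneg fun _ _ => Finset.sum_nonneg fun _ _ => mul_self_nonneg _

theorem frobNorm_nonneg (A : Matrix (Fin m) (Fin n) ℝ) : 0 ≤ frobNorm A :=
  Real.sqrt_nonneg _

theorem frobNorm_sq (A : Matrix (Fin m) (Fin n) ℝ) : frobNorm A ^ 2 = frobInner A A :=
  Real.sq_sqrt (frobInner_self_nonneg A)

theorem frobNorm_smul (c : ℝ) (A : Matrix (Fin m) (Fin n) ℝ) :
    frobNorm (c • A) = |c| * frobNorm A := by
  rw [frobNorm, frobInner_smul_left, frobInner_smul_right, ← mul_assoc,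
    Real.sqrt_mul (mul_self_nonneg c), Real.sqrt_mul_self_eq_abs, frobNorm]

theorem frobNorm_transpose (A : Matrix (Fin m) (Fin n) ℝ) : frobNorm Aᵀ = frobNorm A := by
  rw [frobNorm, frobNorm, frobInner, frobInner, Matrix.transpose_transpose, Matrix.trace_mul_comm]

theorem abs_frobInner_le (A B : Matrix (Fin m) (Fin n) ℝ) :
    |frobInner A B| ≤ frobNorm A * frobNorm B := by
  refine abs_le_of_sq_le_sq ?_ (mul_nonneg (frobNorm_nonneg A) (frobNorm_nonneg B))
  rw [mul_pow, frobNorm_sq, frobNorm_sq]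
  simp only [frobInner_eq_sum, ← Fintype.sum_prod_type', ← sq]
  exact Finset.sum_mul_sq_le_sq_mul_sq _ _ _

theorem frobNorm_add_le (A B : Matrix (Fin m) (Fin n) ℝ) :
    frobNorm (A + B) ≤ frobNorm A + frobNorm B := by
  refine le_of_sq_le_sq ?_ (add_nonneg (frobNorm_nonneg A) (frobNorm_nonneg B))
  have h := (abs_le.mp (abs_frobInner_le A B)).2
  have hA := frobNorm_sq A
  have hB := frobNorm_sq B
  rw [frobNorm_sq, frobInner_add_left, frobInner_add_right, frobInner_add_right,
    frobInner_comm B A]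
  linarith

theorem frobNorm_mul_le (A : Matrix (Fin m) (Fin n) ℝ) (B : Matrix (Fin n) (Fin p) ℝ) :
    frobNorm (A * B) ≤ frobNorm A * frobNorm B := by
  refine le_of_sq_le_sq ?_ (mul_nonneg (frobNorm_nonneg A) (frobNorm_nonneg B))
  rw [mul_pow, frobNorm_sq, frobNorm_sq, frobNorm_sq]
  simp only [frobInner_eq_sum, ← sq, Matrix.mul_apply]
  rw [Finset.sum_comm (f := fun j i => A i j ^ 2), Finset.sum_mul_sum, Finset.sum_comm]
  exact Finset.sum_le_sum fun i _ => Finset.sum_le_sum fun j _ =>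
    Finset.sum_mul_sq_le_sq_mul_sq _ _ _

theorem specNorm_nonneg (A : Matrix (Fin m) (Fin n) ℝ) : 0 ≤ specNorm A := norm_nonneg _

theorem frobNorm_mul_le_specNorm (A : Matrix (Fin m) (Fin n) ℝ) (B : Matrix (Fin n) (Fin p) ℝ) :
    frobNorm (A * B) ≤ specNorm A * frobNorm B := by
  refine le_of_sq_le_sq ?_ (mul_nonneg (specNorm_nonneg A) (frobNorm_nonneg B))
  rw [mul_pow, frobNorm_sq, frobNorm_sq]
  simp only [frobInner_eq_sum, ← sq]
  rw [Finset.mul_sum]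
  refine Finset.sum_le_sum fun j _ => ?_
  have h := ContinuousLinearMap.le_opNorm
    (LinearMap.toContinuousLinearMap (Matrix.toEuclideanLin A)) (WithLp.toLp 2 fun k => B k j)
  have h2 := pow_le_pow_left₀ (norm_nonneg _) h 2
  rw [mul_pow, EuclideanSpace.norm_sq_eq, EuclideanSpace.norm_sq_eq] at h2
  simpa [specNorm, Matrix.mul_apply, Matrix.mulVec, dotProduct] using h2

theorem frobInner_mul_left (A : Matrix (Fin m) (Fin n) ℝ) (B : Matrix (Fin n) (Fin p) ℝ)
    (C : Matrix (Fin m) (Fin p) ℝ) : frobInner (A * B) C = frobInner B (Aᵀ * C) := by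
  simp [frobInner, Matrix.transpose_mul, Matrix.mul_assoc]

theorem frobNorm_transpose_mul_le_specNorm (A : Matrix (Fin m) (Fin n) ℝ)
    (B : Matrix (Fin m) (Fin p) ℝ) : frobNorm (Aᵀ * B) ≤ specNorm A * frobNorm B := by
  rcases (frobNorm_nonneg (Aᵀ * B)).eq_or_lt with h0 | h0
  · rw [← h0]
    exact mul_nonneg (specNorm_nonneg A) (frobNorm_nonneg B)
  · refine le_of_mul_le_mul_right ?_ h0
    calc frobNorm (Aᵀ * B) * frobNorm (Aᵀ * B)
        = frobInner (A * (Aᵀ * B)) B := by rw [← sq, frobNorm_sq, frobInner_mul_left A]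
      _ ≤ frobNorm (A * (Aᵀ * B)) * frobNorm B := (abs_le.mp (abs_frobInner_le _ _)).2
      _ ≤ specNorm A * frobNorm (Aᵀ * B) * frobNorm B :=
        mul_le_mul_of_nonneg_right (frobNorm_mul_le_specNorm _ _) (frobNorm_nonneg B)
      _ = specNorm A * frobNorm B * frobNorm (Aᵀ * B) := by ring

end FrobeniusGeometry

section Smooth

variable {m n : ℕ}

theorem IsGradientOf.hasDerivAt_line {ℓ : Matrix (Fin m) (Fin n) ℝ → ℝ}
    {gradl : Matrix (Fin m) (Fin n) ℝ → Matrix (Fin m) (Fin n) ℝ} (h : IsGradientOf gradl ℓ)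
    (X D : Matrix (Fin m) (Fin n) ℝ) (t : ℝ) :
    HasDerivAt (fun s : ℝ => ℓ (X + s • D)) (frobInner (gradl (X + t • D)) D) t := by
  rw [hasDerivAt_iff_isLittleO_nhds_zero, Asymptotics.isLittleO_iff]
  intro c hc
  have hD : 0 < frobNorm D + 1 := by linarith [frobNorm_nonneg D]
  obtain ⟨δ, hδ, H⟩ := h (X + t • D) (c / (frobNorm D + 1)) (div_pos hc hD)
  filter_upwards [Metric.ball_mem_nhds (0 : ℝ) (div_pos hδ hD)] with s hs
  rw [mem_ball_zero_iff, Real.norm_eq_abs, lt_div_iff₀ hD] at hs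
  have hsD : |s| * frobNorm D ≤ |s| * (frobNorm D + 1) :=
    mul_le_mul_of_nonneg_left (by linarith) (abs_nonneg s)
  have key := H (s • D) (by rw [frobNorm_smul]; linarith)
  rw [frobNorm_smul, frobInner_smul_right, add_assoc, ← add_smul] at key
  rw [smul_eq_mul, Real.norm_eq_abs, Real.norm_eq_abs]
  refine key.trans ?_
  calc c / (frobNorm D + 1) * (|s| * frobNorm D)
      ≤ c / (frobNorm D + 1) * (|s| * (frobNorm D + 1)) :=
        mul_le_mul_of_nonneg_left hsD (div_pos hc hD).le
    _ = c * |s| := by field_simp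

theorem abs_sub_sub_deriv_le_of_hasDerivAt {φ φ' : ℝ → ℝ} {K : ℝ}
    (hφ : ∀ t, HasDerivAt φ (φ' t) t)
    (hK : ∀ t ∈ Set.Icc (0 : ℝ) 1, |φ' t - φ' 0| ≤ K * t) :
    |φ 1 - φ 0 - φ' 0| ≤ K / 2 := by
  have hd (σ t : ℝ) : HasDerivAt (fun s => σ * (φ s - s * φ' 0) - K / 2 * s ^ 2)
      (σ * (φ' t - φ' 0) - K * t) t := by
    have := (((hφ t).sub ((hasDerivAt_id t).mul_const (φ' 0))).const_mul σ).sub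
      ((hasDerivAt_pow 2 t).const_mul (K / 2))
    refine this.congr_deriv ?_
    push_cast
    ring
  have hanti (σ : ℝ) (hσ : |σ| = 1) : σ * (φ 1 - φ 0 - φ' 0) ≤ K / 2 := by
    have := antitoneOn_of_deriv_nonpos (convex_Icc (0 : ℝ) 1)
      (fun t _ => (hd σ t).continuousAt.continuousWithinAt)
      (fun t _ => (hd σ t).differentiableAt.differentiableWithinAt)
      (fun t ht => by
        rw [(hd σ t).deriv, sub_nonpos]
        refine (le_abs_self _).trans ?_
        rw [abs_mul, hσ, one_mul]
        exact hK t (interior_subset ht))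
      (Set.left_mem_Icc.mpr zero_le_one) (Set.right_mem_Icc.mpr zero_le_one) zero_le_one
    norm_num at this
    linarith
  rw [abs_le]
  constructor
  · linarith [hanti (-1) (by simp)]
  · linarith [hanti 1 (by simp)]

/-- The descent lemma on a convex set. -/
theorem IsGradientOf.abs_sub_linearization_le {ℓ : Matrix (Fin m) (Fin n) ℝ → ℝ}
    {gradl : Matrix (Fin m) (Fin n) ℝ → Matrix (Fin m) (Fin n) ℝ} (h : IsGradientOf gradl ℓ)
    {S : Set (Matrix (Fin m) (Fin n) ℝ)} (hS : Convex ℝ S) {K : ℝ}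
    (hLip : ∀ X ∈ S, ∀ X' ∈ S, frobNorm (gradl X - gradl X') ≤ K * frobNorm (X - X'))
    {X Xb : Matrix (Fin m) (Fin n) ℝ} (hX : X ∈ S) (hXb : Xb ∈ S) :
    |ℓ X - ℓ Xb - frobInner (gradl Xb) (X - Xb)| ≤ K / 2 * frobNorm (X - Xb) ^ 2 := by
  have := abs_sub_sub_deriv_le_of_hasDerivAt (K := K * frobNorm (X - Xb) ^ 2)
    (fun t => h.hasDerivAt_line Xb (X - Xb) t) fun t ht => by
      rw [zero_smul, add_zero, ← frobInner_sub_left]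
      calc _ ≤ frobNorm (gradl (Xb + t • (X - Xb)) - gradl Xb) * frobNorm (X - Xb) :=
            abs_frobInner_le _ _
        _ ≤ K * frobNorm (Xb + t • (X - Xb) - Xb) * frobNorm (X - Xb) :=
            mul_le_mul_of_nonneg_right (hLip _ (hS.add_smul_sub_mem hXb hX ht) _ hXb)
              (frobNorm_nonneg _)
        _ = K * frobNorm (X - Xb) ^ 2 * t := by
            rw [add_sub_cancel_left, frobNorm_smul, abs_of_nonneg ht.1]
            ring
  simp only [one_smul, zero_smul, add_zero, add_sub_cancel] at this
  rwa [mul_div_right_comm] at this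

end Smooth

section Constraint

variable {m n : ℕ}

theorem Gm_isSymm (X : Matrix (Fin m) (Fin n) ℝ) : (Gm X).IsSymm := by
  simp [Gm, Matrix.IsSymm, Matrix.transpose_mul]

theorem Gm_add (X D : Matrix (Fin m) (Fin n) ℝ) :
    Gm (X + D) = Gm X + (Xᵀ * D + Dᵀ * X + Dᵀ * D) := by
  simp only [Gm, Matrix.transpose_add, Matrix.add_mul, Matrix.mul_add]
  abel

theorem Matrix.IsSymm.frobInner_transpose_mul_add {Y : Matrix (Fin n) (Fin n) ℝ} (hY : Y.IsSymm)
    (X D : Matrix (Fin m) (Fin n) ℝ) :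
    frobInner Y (Xᵀ * D + Dᵀ * X) = 2 * frobInner (X * Y) D := by
  have h : frobInner Y (Dᵀ * X) = frobInner Y (Xᵀ * D) := by
    rw [frobInner, frobInner, ← Matrix.trace_transpose, Matrix.trace_mul_comm Yᵀ (Xᵀ * D)]
    simp [Matrix.transpose_mul, hY.eq]
  rw [frobInner_add_right, h, frobInner_mul_left]
  ring

theorem frobInner_Gm_transpose_mul_self (X D : Matrix (Fin m) (Fin n) ℝ) :
    frobInner (Gm X) (Dᵀ * D) = frobNorm (X * Dᵀ) ^ 2 - frobNorm D ^ 2 := by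
  rw [frobNorm_sq, frobNorm_sq, frobInner, (Gm_isSymm X).eq]
  simp only [frobInner, Gm, Matrix.sub_mul, Matrix.trace_sub, Matrix.one_mul,
    Matrix.transpose_mul, Matrix.transpose_transpose]
  rw [← Matrix.mul_assoc (Xᵀ * X), Matrix.trace_mul_comm _ D]
  simp only [Matrix.mul_assoc]

theorem frobNorm_Gm_sub_Gm_le {X Xb : Matrix (Fin m) (Fin n) ℝ} {R : ℝ}
    (hX : specNorm X ≤ R) (hXb : specNorm Xb ≤ R) :
    frobNorm (Gm X - Gm Xb) ≤ 2 * R * frobNorm (X - Xb) := by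
  have hsplit : Gm X - Gm Xb = Xᵀ * (X - Xb) + (Xbᵀ * (X - Xb))ᵀ := by
    simp only [Gm, Matrix.mul_sub, Matrix.transpose_sub, Matrix.transpose_mul,
      Matrix.transpose_transpose]
    abel
  have h1 := mul_le_mul_of_nonneg_right hX (frobNorm_nonneg (X - Xb))
  have h2 := mul_le_mul_of_nonneg_right hXb (frobNorm_nonneg (X - Xb))
  have h3 := frobNorm_transpose_mul_le_specNorm X (X - Xb)
  have h4 := frobNorm_transpose_mul_le_specNorm Xb (X - Xb)
  have h5 := frobNorm_add_le (Xᵀ * (X - Xb)) (Xbᵀ * (X - Xb))ᵀ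
  rw [frobNorm_transpose] at h5
  rw [hsplit]
  linarith

theorem frobInner_Gm_sub_linearization {Y : Matrix (Fin n) (Fin n) ℝ} (hY : Y.IsSymm)
    (X Xb : Matrix (Fin m) (Fin n) ℝ) :
    frobInner Y (Gm X) = frobInner Y (Gm Xb) + 2 * frobInner (Xb * Y) (X - Xb)
      + frobInner Y ((X - Xb)ᵀ * (X - Xb)) := by
  have h := Gm_add Xb (X - Xb)
  rw [add_sub_cancel] at h
  rw [h, frobInner_add_right, frobInner_add_right, hY.frobInner_transpose_mul_add]
  ring

theorem frobNorm_Gm_sq_sub_linearization (X Xb : Matrix (Fin m) (Fin n) ℝ) :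
    frobNorm (Gm X) ^ 2 = frobNorm (Gm Xb) ^ 2 + 4 * frobInner (Xb * Gm Xb) (X - Xb)
      + 2 * frobInner (Gm Xb) ((X - Xb)ᵀ * (X - Xb)) + frobNorm (Gm X - Gm Xb) ^ 2 := by
  have h := frobInner_Gm_sub_linearization (Gm_isSymm Xb) X Xb
  have hX : Gm X = Gm Xb + (Gm X - Gm Xb) := by abel
  have hc : frobInner (Gm Xb) (Gm X)
      = frobInner (Gm Xb) (Gm Xb) + frobInner (Gm Xb) (Gm X - Gm Xb) := by
    rw [← frobInner_add_right, ← hX]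
  have hs : frobInner (Gm X) (Gm X) = frobInner (Gm Xb) (Gm Xb)
      + 2 * frobInner (Gm Xb) (Gm X - Gm Xb) + frobInner (Gm X - Gm Xb) (Gm X - Gm Xb) := by
    conv_lhs => rw [hX]
    rw [frobInner_add_left, frobInner_add_right, frobInner_add_right,
      frobInner_comm (Gm X - Gm Xb) (Gm Xb)]
    ring
  rw [frobNorm_sq, frobNorm_sq, frobNorm_sq]
  linarith

end Constraint

/-- Bounds relating the augmented Lagrangian and its linearization:
`−((L_ρ+λ⁻¹)/2)‖X−X̄‖² ≤ ℒ_ρ(X,Y) − ℒ_{X̄,λ}(X,Y) ≤ ((L_ρ−λ⁻¹)/2)‖X−X̄‖²`. -/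
theorem linearization_error_bounds {m n : ℕ} (hmn : n ≤ m)
    (𝒳 : Set (Matrix (Fin m) (Fin n) ℝ)) (𝒴 : Set (Matrix (Fin n) (Fin n) ℝ))
    (ℓ g : Matrix (Fin m) (Fin n) ℝ → ℝ)
    (gradl : Matrix (Fin m) (Fin n) ℝ → Matrix (Fin m) (Fin n) ℝ)
    (Lℓ Lg ρ RX RY Lρ lam : ℝ)
    (h𝒳conv : Convex ℝ 𝒳) (h𝒳cpt : IsCompact 𝒳)
    (h𝒳R : ∀ X ∈ 𝒳, specNorm X ≤ RX)
    (hgrad : IsGradientOf gradl ℓ) (hgradcont : Continuous gradl)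
    (hgradLip : ∀ X ∈ 𝒳, ∀ X' ∈ 𝒳, frobNorm (gradl X - gradl X') ≤ Lℓ * frobNorm (X - X'))
    (hgwc : ConvexOn ℝ 𝒳 (fun X => g X + Lg / 2 * frobNorm X ^ 2))
    (h𝒴symm : ∀ Y ∈ 𝒴, Y.IsSymm) (h𝒴conv : Convex ℝ 𝒴) (h𝒴cpt : IsCompact 𝒴)
    (h𝒴R : ∀ Y ∈ 𝒴, frobNorm Y ≤ RY)
    (hρ : 0 ≤ ρ) (hlam : 0 < lam)
    (hLρ : Lρ = Lℓ + 2 * RY + 6 * ρ * RX ^ 2 + 2 * ρ) :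
    ∀ Y ∈ 𝒴, ∀ X ∈ 𝒳, ∀ Xb ∈ 𝒳,
      -((Lρ + lam⁻¹) / 2) * frobNorm (X - Xb) ^ 2
          ≤ Lag ℓ g ρ X Y - LinLag ℓ g gradl ρ lam Xb X Y ∧
      Lag ℓ g ρ X Y - LinLag ℓ g gradl ρ lam Xb X Y
          ≤ (Lρ - lam⁻¹) / 2 * frobNorm (X - Xb) ^ 2 := by
  intro Y hY X hX Xb hXb
  have hRX : 0 ≤ RX := (specNorm_nonneg X).trans (h𝒳R X hX)
  obtain ⟨hℓ1, hℓ2⟩ := abs_le.mp (hgrad.abs_sub_linearization_le h𝒳conv hgradLip hX hXb)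
  have hYG := frobInner_Gm_sub_linearization (h𝒴symm Y hY) X Xb
  have hGG := frobNorm_Gm_sq_sub_linearization X Xb
  have hGD := frobInner_Gm_transpose_mul_self Xb (X - Xb)
  have hdiff : frobNorm (Gm X - Gm Xb) ^ 2 ≤ 4 * RX ^ 2 * frobNorm (X - Xb) ^ 2 := by
    calc _ ≤ (2 * RX * frobNorm (X - Xb)) ^ 2 :=
          pow_le_pow_left₀ (frobNorm_nonneg _)
            (frobNorm_Gm_sub_Gm_le (h𝒳R X hX) (h𝒳R Xb hXb)) 2
      _ = _ := by ring
  have hXbD : frobNorm (Xb * (X - Xb)ᵀ) ^ 2 ≤ RX ^ 2 * frobNorm (X - Xb) ^ 2 := by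
    rw [← mul_pow]
    refine pow_le_pow_left₀ (frobNorm_nonneg _) ((frobNorm_mul_le_specNorm _ _).trans ?_) 2
    rw [frobNorm_transpose]
    exact mul_le_mul_of_nonneg_right (h𝒳R Xb hXb) (frobNorm_nonneg _)
  have hYD : |frobInner Y ((X - Xb)ᵀ * (X - Xb))| ≤ RY * frobNorm (X - Xb) ^ 2 := by
    refine (abs_frobInner_le _ _).trans
      (mul_le_mul (h𝒴R Y hY) ?_ (frobNorm_nonneg _) ((frobNorm_nonneg Y).trans (h𝒴R Y hY)))
    have := frobNorm_mul_le (X - Xb)ᵀ (X - Xb)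
    rwa [frobNorm_transpose, ← sq] at this
  obtain ⟨hY1, hY2⟩ := abs_le.mp hYD
  have hlin : frobInner ((2 : ℝ) • (Xb * (Y + ρ • Gm Xb))) (X - Xb)
      = 2 * frobInner (Xb * Y) (X - Xb) + 2 * ρ * frobInner (Xb * Gm Xb) (X - Xb) := by
    rw [frobInner_smul_left, Matrix.mul_add, frobInner_add_left, Matrix.mul_smul,
      frobInner_smul_left]
    ring
  have hdecomp : Lag ℓ g ρ X Y - LinLag ℓ g gradl ρ lam Xb X Y
      = (ℓ X - ℓ Xb - frobInner (gradl Xb) (X - Xb)) + frobInner Y ((X - Xb)ᵀ * (X - Xb))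
        + ρ * (frobNorm (Xb * (X - Xb)ᵀ) ^ 2 - frobNorm (X - Xb) ^ 2
          + frobNorm (Gm X - Gm Xb) ^ 2 / 2)
        - lam⁻¹ / 2 * frobNorm (X - Xb) ^ 2 := by
    rw [Lag, LinLag, hlin, hYG, hGG, hGD, one_div, mul_inv]
    ring
  have hD := sq_nonneg (frobNorm (X - Xb))
  have hup : ρ * (frobNorm (Xb * (X - Xb)ᵀ) ^ 2 - frobNorm (X - Xb) ^ 2
      + frobNorm (Gm X - Gm Xb) ^ 2 / 2) ≤ ρ * ((3 * RX ^ 2 + 1) * frobNorm (X - Xb) ^ 2) :=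
    mul_le_mul_of_nonneg_left (by linarith) hρ
  have hlow : ρ * (-((3 * RX ^ 2 + 1) * frobNorm (X - Xb) ^ 2))
      ≤ ρ * (frobNorm (Xb * (X - Xb)ᵀ) ^ 2 - frobNorm (X - Xb) ^ 2
        + frobNorm (Gm X - Gm Xb) ^ 2 / 2) :=
    mul_le_mul_of_nonneg_left (by
      linarith [mul_nonneg (sq_nonneg RX) hD, sq_nonneg (frobNorm (Xb * (X - Xb)ᵀ)),
        sq_nonneg (frobNorm (Gm X - Gm Xb))]) hρ
  rw [hdecomp, hLρ]
  constructor <;> linarith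

end
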